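/- Let X ∈ R^{ℓ×q×n} satisfy ‖X‖ ≤ R, let A_i ∈ R^{1×ℓ×n} and B_i ∈ R^{1×q×n}, let C ∈ {0,1}^{ℓ×ℓ×n}, and let Ã_i = D ∘ A_i for a random binary mask D satisfying E_D[Ã_i* ∗ Ã_i] = p²·A_i* ∗ A_i + (p − p²)·C ∘ (A_i* ∗ A_i) and E_D[Ã_i] = p·A_i. Then E_D[‖Ã_i ∗ X − p·B_i‖²] ≤ p²‖A_i ∗ X‖² + (p − p²)·n·‖A_i‖²·R² − 2p²⟨A_i ∗ X, B_i⟩ + p²‖B_i‖². -/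

import Mathlib

open MeasureTheory ProbabilityTheory
open scoped BigOperators RealInnerProductSpace

noncomputable section

/-- A third-order real tensor of dimensions `m × l × n`. -/
abbrev Tensor (m l n : ℕ) : Type := Fin m → Fin l → Fin n → ℝ

/-- The t-product of third-order tensors. -/
def tmul {m l q n : ℕ} (X : Tensor m l n) (Y : Tensor l q n) : Tensor m q n :=
  fun i j k => ∑ s : Fin l, ∑ r : Fin n, X i s r * Y s j (k - r)

/-- The tensor transpose: transpose each frontal slice and reverse the order of
slices `1, …, n-1`. -/
def ttransp {m l n : ℕ} (X : Tensor m l n) : Tensor l m n :=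
  fun j i k => X i j (-k)

/-- The Frobenius norm of a tensor. -/
def tnorm {m l n : ℕ} (X : Tensor m l n) : ℝ :=
  Real.sqrt (∑ i, ∑ j, ∑ k, (X i j k) ^ 2)

/-- The Frobenius inner product of two tensors. -/
def tinner {m l n : ℕ} (X Y : Tensor m l n) : ℝ :=
  ∑ i, ∑ j, ∑ k, X i j k * Y i j k

/-- The Hadamard (entrywise) product of two tensors. -/
def had {m l n : ℕ} (C X : Tensor m l n) : Tensor m l n :=
  fun i j k => C i j k * X i j k

/-- The `i`-th row slice of a tensor, viewed as a `1 × l × n` tensor. -/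
def rowSlice {m l n : ℕ} (A : Tensor m l n) (i : Fin m) : Tensor 1 l n :=
  fun _ s k => A i s k

theorem tnorm_nonneg {m l n : ℕ} (X : Tensor m l n) : 0 ≤ tnorm X :=
  Real.sqrt_nonneg _

theorem tnorm_sq {m l n : ℕ} (X : Tensor m l n) :
    tnorm X ^ 2 = ∑ i, ∑ j, ∑ k, X i j k ^ 2 :=
  Real.sq_sqrt (by positivity)

theorem tnorm_ttransp {m l n : ℕ} (X : Tensor m l n) : tnorm (ttransp X) = tnorm X := by
  rcases n with _ | n
  · simp [tnorm]
  · unfold tnorm ttransp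
    rw [Finset.sum_comm]
    congr! 3 with i _ j
    exact Equiv.sum_comp (Equiv.neg (Fin (n + 1))) fun k => X i j k ^ 2

theorem tnorm_had_le {m l n : ℕ} {C : Tensor m l n} (hC : ∀ i j k, C i j k = 0 ∨ C i j k = 1)
    (X : Tensor m l n) : tnorm (had C X) ≤ tnorm X := by
  refine Real.sqrt_le_sqrt ?_
  refine Finset.sum_le_sum fun i _ => Finset.sum_le_sum fun j _ => Finset.sum_le_sum fun k _ => ?_
  rcases hC i j k with h | h <;> simp [had, h, sq_nonneg]

/-- The Cauchy–Schwarz inequality for the Frobenius inner product. -/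
theorem tinner_le_tnorm_mul_tnorm {m l n : ℕ} (X Y : Tensor m l n) :
    tinner X Y ≤ tnorm X * tnorm Y := by
  have h := Real.sum_mul_le_sqrt_mul_sqrt Finset.univ
    (fun t : Fin m × Fin l × Fin n => X t.1 t.2.1 t.2.2) (fun t => Y t.1 t.2.1 t.2.2)
  simpa only [Fintype.sum_prod_type, tinner, tnorm] using h

theorem tinner_add_smul_left {m l n : ℕ} (a b : ℝ) (X Y Z : Tensor m l n) :
    tinner (fun i j k => a * X i j k + b * Y i j k) Z = a * tinner X Z + b * tinner Y Z := by
  simp only [tinner, Finset.mul_sum, ← Finset.sum_add_distrib]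
  congr! 3
  ring

theorem tnorm_sub_smul_sq {m l n : ℕ} (p : ℝ) (X Y : Tensor m l n) :
    tnorm (X - p • Y) ^ 2 = tnorm X ^ 2 - 2 * p * tinner X Y + p ^ 2 * tnorm Y ^ 2 := by
  simp only [tnorm_sq, tinner, Finset.mul_sum, ← Finset.sum_add_distrib,
    ← Finset.sum_sub_distrib, Pi.sub_apply, Pi.smul_apply, smul_eq_mul]
  congr! 3
  ring

theorem tmul_smul_left {m l q n : ℕ} (a : ℝ) (X : Tensor m l n) (Y : Tensor l q n) :
    tmul (a • X) Y = a • tmul X Y := by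
  ext i j k
  simp [tmul, Finset.mul_sum, mul_assoc]

theorem tinner_smul_left {m l n : ℕ} (a : ℝ) (X Y : Tensor m l n) :
    tinner (a • X) Y = a * tinner X Y := by
  simp [tinner, Finset.mul_sum, mul_assoc]

/-- The Frobenius norm is submultiplicative for the t-product up to the factor `√n`. -/
theorem tnorm_tmul_sq_le {m l q n : ℕ} (X : Tensor m l n) (Y : Tensor l q n) :
    tnorm (tmul X Y) ^ 2 ≤ n * tnorm X ^ 2 * tnorm Y ^ 2 := by
  rcases n with _ | n
  · simp [tnorm]
  have h (i : Fin m) (j : Fin q) (k : Fin (n + 1)) :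
      tmul X Y i j k ^ 2 ≤ (∑ s, ∑ r, X i s r ^ 2) * ∑ s, ∑ r, Y s j r ^ 2 := by
    have hcs := Finset.sum_mul_sq_le_sq_mul_sq Finset.univ
      (fun t : Fin l × Fin (n + 1) => X i t.1 t.2) (fun t => Y t.1 j (k - t.2))
    simp only [Fintype.sum_prod_type] at hcs
    have hshift (s : Fin l) : ∑ r, Y s j (k - r) ^ 2 = ∑ r, Y s j r ^ 2 :=
      Equiv.sum_comp (Equiv.subLeft k) fun r => Y s j r ^ 2
    simpa only [hshift, tmul] using hcs
  calc tnorm (tmul X Y) ^ 2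
      ≤ ∑ i, ∑ j, ∑ _k : Fin (n + 1),
          (∑ s, ∑ r, X i s r ^ 2) * ∑ s, ∑ r, Y s j r ^ 2 := by
        rw [tnorm_sq]
        gcongr with i _ j _ k
        exact h i j k
    _ = (n + 1 : ℕ) * tnorm X ^ 2 * tnorm Y ^ 2 := by
        simp only [Finset.sum_const, Finset.card_univ, Fintype.card_fin, nsmul_eq_mul,
          ← Finset.mul_sum, ← Finset.sum_mul]
        rw [tnorm_sq, tnorm_sq, Finset.sum_comm (f := fun j s => ∑ r, Y s j r ^ 2), mul_assoc]

/-- The squared norm of a t-product is the inner product of the two Gram tensors. -/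
theorem tnorm_tmul_sq {m l q n : ℕ} (X : Tensor m l n) (Y : Tensor l q n) :
    tnorm (tmul X Y) ^ 2 = tinner (tmul (ttransp X) X) (tmul Y (ttransp Y)) := by
  rcases n with _ | n
  · simp [tnorm, tinner]
  have hY (s s' : Fin l) (r t : Fin (n + 1)) :
      ∑ j, ∑ k, Y s j (k - r) * Y s' j (k - (r + t)) = tmul Y (ttransp Y) s s' t := by
    simp only [tmul, ttransp]
    congr! 1 with j
    refine Fintype.sum_equiv (Equiv.subRight r) _ _ fun k => ?_
    simp [sub_sub]
  have hX (s s' : Fin l) (t : Fin (n + 1)) :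
      tmul (ttransp X) X s s' t = ∑ i, ∑ r, X i s r * X i s' (r + t) := by
    simp only [tmul, ttransp]
    congr! 1 with i
    refine Fintype.sum_equiv (Equiv.neg _) _ _ fun r => ?_
    simp [sub_eq_neg_add]
  calc tnorm (tmul X Y) ^ 2
      = ∑ i, ∑ j, ∑ k, ∑ s, ∑ r, ∑ s', ∑ t,
          (X i s r * X i s' (r + t)) * (Y s j (k - r) * Y s' j (k - (r + t))) := by
        rw [tnorm_sq]
        congr! 3 with i _ j _ k
        simp only [tmul, sq, Finset.sum_mul, Finset.mul_sum]
        congr! 3 with s _ r _ s'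
        rw [← Equiv.sum_comp (Equiv.addLeft r)]
        congr! 1 with t
        simp only [Equiv.coe_addLeft]
        ring
    _ = ∑ i, ∑ s, ∑ r, ∑ s', ∑ t, ∑ j, ∑ k,
          (X i s r * X i s' (r + t)) * (Y s j (k - r) * Y s' j (k - (r + t))) := by
        congr! 1 with i
        have h := Finset.sum_comm (s := Finset.univ) (t := Finset.univ)
          (f := fun (u : Fin q × Fin (n + 1))
              (v : Fin l × Fin (n + 1) × Fin l × Fin (n + 1)) =>
            (X i v.1 v.2.1 * X i v.2.2.1 (v.2.1 + v.2.2.2)) *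
              (Y v.1 u.1 (u.2 - v.2.1) * Y v.2.2.1 u.1 (u.2 - (v.2.1 + v.2.2.2))))
        simpa only [Fintype.sum_prod_type] using h
    _ = ∑ i, ∑ s, ∑ r, ∑ s', ∑ t,
          (X i s r * X i s' (r + t)) * tmul Y (ttransp Y) s s' t := by
        simp only [← Finset.mul_sum, hY]
    _ = tinner (tmul (ttransp X) X) (tmul Y (ttransp Y)) := by
        simp only [tinner, hX, Finset.sum_mul]
        rw [Finset.sum_comm]
        congr! 1 with s
        have h := Finset.sum_comm (s := Finset.univ) (t := Finset.univ)
          (f := fun (u : Fin m × Fin (n + 1)) (v : Fin l × Fin (n + 1)) =>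
            X u.1 s u.2 * X u.1 v.1 (u.2 + v.2) * tmul Y (ttransp Y) s v.1 v.2)
        simpa only [Fintype.sum_prod_type] using h

theorem tinner_had_gram_le {m l q n : ℕ} {C : Tensor l l n}
    (hC : ∀ i j k, C i j k = 0 ∨ C i j k = 1) (X : Tensor m l n) (Y : Tensor l q n) :
    tinner (had C (tmul (ttransp X) X)) (tmul Y (ttransp Y))
      ≤ n * tnorm X ^ 2 * tnorm Y ^ 2 := by
  have hX := tnorm_tmul_sq_le (ttransp X) X
  have hY := tnorm_tmul_sq_le Y (ttransp Y)
  rw [tnorm_ttransp] at hX hY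
  calc _ ≤ tnorm (had C (tmul (ttransp X) X)) * tnorm (tmul Y (ttransp Y)) :=
        tinner_le_tnorm_mul_tnorm _ _
    _ ≤ tnorm (tmul (ttransp X) X) * tnorm (tmul Y (ttransp Y)) :=
        mul_le_mul_of_nonneg_right (tnorm_had_le hC _) (tnorm_nonneg _)
    _ ≤ n * tnorm X ^ 2 * tnorm Y ^ 2 := by
        refine le_of_sq_le_sq ?_ (by positivity)
        rw [mul_pow]
        calc _ ≤ (n * tnorm X ^ 2 * tnorm X ^ 2) * (n * tnorm Y ^ 2 * tnorm Y ^ 2) := by gcongr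
          _ = _ := by ring

section Expectation

variable {Ω : Type*} [MeasurableSpace Ω] {μ : Measure Ω}

theorem integrable_tinner {m l n : ℕ} {T : Ω → Tensor m l n}
    (hT : ∀ i j k, Integrable (fun ω => T ω i j k) μ) (Y : Tensor m l n) :
    Integrable (fun ω => tinner (T ω) Y) μ :=
  integrable_finsetSum _ fun i _ => integrable_finsetSum _ fun j _ =>
    integrable_finsetSum _ fun k _ => (hT i j k).mul_const _

theorem integral_tinner {m l n : ℕ} {T : Ω → Tensor m l n}
    (hT : ∀ i j k, Integrable (fun ω => T ω i j k) μ) (Y : Tensor m l n) :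
    ∫ ω, tinner (T ω) Y ∂μ = tinner (fun i j k => ∫ ω, T ω i j k ∂μ) Y := by
  have h i j k := (hT i j k).mul_const (Y i j k)
  simp only [tinner]
  rw [integral_finsetSum _ fun i _ => integrable_finsetSum _ fun j _ =>
    integrable_finsetSum _ fun k _ => h i j k]
  congr! 1 with i
  rw [integral_finsetSum _ fun j _ => integrable_finsetSum _ fun k _ => h i j k]
  congr! 1 with j
  rw [integral_finsetSum _ fun k _ => h i j k]
  congr! 1 with k
  exact integral_mul_const _ _

theorem integrable_tmul_left {m l q n : ℕ} {T : Ω → Tensor m l n}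
    (hT : ∀ i j k, Integrable (fun ω => T ω i j k) μ) (Y : Tensor l q n) (i : Fin m)
    (j : Fin q) (k : Fin n) : Integrable (fun ω => tmul (T ω) Y i j k) μ :=
  integrable_finsetSum _ fun s _ => integrable_finsetSum _ fun r _ => (hT i s r).mul_const _

theorem integral_tmul_left {m l q n : ℕ} {T : Ω → Tensor m l n}
    (hT : ∀ i j k, Integrable (fun ω => T ω i j k) μ) (Y : Tensor l q n) (i : Fin m)
    (j : Fin q) (k : Fin n) :
    ∫ ω, tmul (T ω) Y i j k ∂μ = tmul (fun i j k => ∫ ω, T ω i j k ∂μ) Y i j k := by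
  have h s r := (hT i s r).mul_const (Y s j (k - r))
  simp only [tmul]
  rw [integral_finsetSum _ fun s _ => integrable_finsetSum _ fun r _ => h s r]
  congr! 1 with s
  rw [integral_finsetSum _ fun r _ => h s r]
  congr! 1 with r
  exact integral_mul_const _ _

theorem memLp_two_had [IsFiniteMeasure μ] {m l n : ℕ} {D : Ω → Tensor m l n}
    (hmeas : ∀ i j k, Measurable fun ω => D ω i j k)
    (h01 : ∀ ω i j k, D ω i j k = 0 ∨ D ω i j k = 1) (A : Tensor m l n) (i : Fin m)
    (j : Fin l) (k : Fin n) : MemLp (fun ω => had (D ω) A i j k) 2 μ := by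
  refine MemLp.of_bound ((hmeas i j k).mul_const _).aestronglyMeasurable |A i j k| ?_
  filter_upwards with ω
  rcases h01 ω i j k with h | h <;> simp [had, h]

end Expectation

/-- for `‖X‖ ≤ R`, a `{0,1}`-valued `C`, and a random mask `D` with
`E_D[Ã* ∗ Ã] = p² A* ∗ A + (p − p²) C ∘ (A* ∗ A)` and `E_D[Ã] = p A`
(where `Ã = D ∘ A` for the row slice `A ∈ ℝ^{1×l×n}`), one has
`E_D[‖Ã ∗ X − p B‖²] ≤ p²‖A ∗ X‖² + (p − p²) n ‖A‖² R² − 2p²⟨A ∗ X, B⟩ + p²‖B‖²`. -/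
theorem expected_residual_bound {l q n : ℕ} {Ω : Type*} [MeasurableSpace Ω]
    (μ : Measure Ω) [IsProbabilityMeasure μ] (p R : ℝ) (hp0 : 0 ≤ p) (hp1 : p ≤ 1)
    (A : Tensor 1 l n) (B : Tensor 1 q n) (X : Tensor l q n)
    (hXR : tnorm X ≤ R)
    (C : Tensor l l n) (hC : ∀ x y r, C x y r = 0 ∨ C x y r = 1)
    (D : Ω → Tensor 1 l n)
    (hmeas : ∀ i j k, Measurable fun ω => D ω i j k)
    (h01 : ∀ ω i j k, D ω i j k = 0 ∨ D ω i j k = 1)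
    (hgram : ∀ (x y : Fin l) (r : Fin n),
      ∫ ω, tmul (ttransp (had (D ω) A)) (had (D ω) A) x y r ∂μ
        = p ^ 2 * tmul (ttransp A) A x y r
          + (p - p ^ 2) * had C (tmul (ttransp A) A) x y r)
    (hEA : ∀ (i : Fin 1) (j : Fin l) (k : Fin n),
      ∫ ω, had (D ω) A i j k ∂μ = p * A i j k) :
    ∫ ω, tnorm (tmul (had (D ω) A) X - p • B) ^ 2 ∂μ
      ≤ p ^ 2 * tnorm (tmul A X) ^ 2 + (p - p ^ 2) * n * tnorm A ^ 2 * R ^ 2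
        - 2 * p ^ 2 * tinner (tmul A X) B + p ^ 2 * tnorm B ^ 2 := by
  have hL2 := memLp_two_had (μ := μ) hmeas h01 A
  have hint i j k : Integrable (fun ω => had (D ω) A i j k) μ :=
    (hL2 i j k).integrable one_le_two
  have hgint x y r :
      Integrable (fun ω => tmul (ttransp (had (D ω) A)) (had (D ω) A) x y r) μ :=
    integrable_finsetSum _ fun i _ => integrable_finsetSum _ fun t _ =>
      (hL2 i x (-t)).integrable_mul (hL2 i y (r - t))
  have hquad : ∫ ω, tnorm (tmul (had (D ω) A) X) ^ 2 ∂μ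
      = p ^ 2 * tnorm (tmul A X) ^ 2
        + (p - p ^ 2) * tinner (had C (tmul (ttransp A) A)) (tmul X (ttransp X)) := by
    simp only [tnorm_tmul_sq]
    rw [integral_tinner hgint]
    simp only [hgram]
    exact tinner_add_smul_left _ _ _ _ _
  have hcross : ∫ ω, tinner (tmul (had (D ω) A) X) B ∂μ = p * tinner (tmul A X) B := by
    rw [integral_tinner (integrable_tmul_left hint X)]
    simp only [integral_tmul_left hint X, hEA]
    rw [← tinner_smul_left, ← tmul_smul_left]
    rfl
  have hquad_int : Integrable (fun ω => tnorm (tmul (had (D ω) A) X) ^ 2) μ := by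
    simpa only [tnorm_tmul_sq] using integrable_tinner hgint _
  have hcross_int : Integrable (fun ω => 2 * p * tinner (tmul (had (D ω) A) X) B) μ :=
    (integrable_tinner (integrable_tmul_left hint X) B).const_mul _
  simp only [tnorm_sub_smul_sq]
  rw [integral_add (by exact hquad_int.sub hcross_int) (integrable_const _),
    integral_sub hquad_int hcross_int, integral_const_mul, hquad, hcross, integral_const,
    probReal_univ, one_smul]
  have hbound : tinner (had C (tmul (ttransp A) A)) (tmul X (ttransp X))
      ≤ n * tnorm A ^ 2 * R ^ 2 := by
    refine (tinner_had_gram_le hC A X).trans ?_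
    have := tnorm_nonneg X
    gcongr
  have hp : 0 ≤ p - p ^ 2 := by nlinarith
  linarith [mul_le_mul_of_nonneg_left hbound hp]
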